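/- For each r ∈ {0, 1, 2}, as ℓ → ∞ over positive integers, ∫₀^{π/2} [P_ℓ^{(r)}(cos φ)·sin^r φ]⁴ · sin φ dφ = (3/(2π²))·ℓ^{4r−2}·log ℓ + O(ℓ^{4r−2}). -/

import Mathlib

open Real

/-- The `ℓ`-th Legendre polynomial via Rodrigues' formula:
`P_ℓ(x) = (1/(2^ℓ ℓ!)) (d/dx)^ℓ (x²−1)^ℓ`. -/
noncomputable def legendreP (l : ℕ) (x : ℝ) : ℝ :=
  (1 / (2 ^ l * (Nat.factorial l : ℝ))) * iteratedDeriv l (fun y => (y ^ 2 - 1) ^ l) x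


lemma sin_lower {x : ℝ} (h0 : 0 < x) (h1 : x ≤ π / 2) : x / 2 ≤ Real.sin x := by
  have h := Real.mul_le_sin h0.le h1
  have h2 : (1:ℝ)/2 ≤ 2 / π := by
    rw [div_le_div_iff₀ (by norm_num) Real.pi_pos]; linarith [Real.pi_le_four]
  nlinarith

lemma gron (lam : ℝ) (hl : 1 ≤ lam) (u w : ℝ → ℝ)
    (hu : ∀ φ ∈ Set.Ioo 0 π, HasDerivAt u (lam * w φ) φ)
    (hw : ∀ φ ∈ Set.Ioo 0 π, HasDerivAt w (-lam * u φ - u φ / (4 * lam * Real.sin φ ^ 2)) φ)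
    (φ : ℝ) (h1 : 1 / lam ≤ φ) (h2 : φ ≤ π / 2) :
    |(u φ ^ 2 + w φ ^ 2) - (u (π/2) ^ 2 + w (π/2) ^ 2)| ≤
      (u (π/2) ^ 2 + w (π/2) ^ 2) / (lam * φ) := by
  have hl0 : 0 < lam := by linarith
  have hφ0 : 0 < φ := lt_of_lt_of_le (by positivity) h1
  have hpi := Real.pi_pos
  set ρ : ℝ → ℝ := fun x => u x ^ 2 + w x ^ 2 with hρ
  have hsub : ∀ x ∈ Set.Icc φ (π/2), x ∈ Set.Ioo 0 π := fun x hx =>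
    ⟨lt_of_lt_of_le hφ0 hx.1, by linarith [hx.2]⟩
  have hder : ∀ ε : ℝ, ∀ x ∈ Set.Ioo 0 π, HasDerivAt
      (fun x => ρ x * Real.exp (ε * (Real.cos x / Real.sin x / (4 * lam))))
      (Real.exp (ε * (Real.cos x / Real.sin x / (4 * lam))) *
        ((- 2 * u x * w x - ε * (u x ^ 2 + w x ^ 2)) / (4 * lam * Real.sin x ^ 2))) x := by
    intro ε x hx
    have hs : 0 < Real.sin x := Real.sin_pos_of_mem_Ioo hx
    have d1 := ((hu x hx).pow 2).add ((hw x hx).pow 2)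
    have d2 := (((((Real.hasDerivAt_cos x).div (Real.hasDerivAt_sin x) hs.ne').div_const
      (4 * lam)).const_mul ε).exp)
    have d3 := d1.mul d2
    refine d3.congr_deriv ?_
    have e : -Real.sin x * Real.sin x - Real.cos x * Real.cos x = -1 := by
      nlinarith [Real.sin_sq_add_cos_sq x]
    simp only [Pi.add_apply, Pi.pow_apply, Pi.div_apply]
    rw [e]
    field_simp
    ring
  have hcont : ∀ ε : ℝ, ContinuousOn
      (fun x => ρ x * Real.exp (ε * (Real.cos x / Real.sin x / (4 * lam)))) (Set.Icc φ (π/2)) :=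
    fun ε x hx => (hder ε x (hsub x hx)).continuousAt.continuousWithinAt
  have hmono : MonotoneOn (fun x => ρ x * Real.exp ((-1) * (Real.cos x / Real.sin x / (4 * lam))))
      (Set.Icc φ (π/2)) := by
    apply monotoneOn_of_deriv_nonneg (convex_Icc _ _) (hcont _)
    · intro x hx
      exact (hder _ x (hsub x (interior_subset hx))).differentiableAt.differentiableWithinAt
    · intro x hx
      rw [(hder _ x (hsub x (interior_subset hx))).deriv]
      have : 0 ≤ - 2 * u x * w x - (-1) * (u x ^ 2 + w x ^ 2) := by nlinarith [sq_nonneg (u x - w x)]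
      positivity
  have hanti : AntitoneOn (fun x => ρ x * Real.exp (1 * (Real.cos x / Real.sin x / (4 * lam))))
      (Set.Icc φ (π/2)) := by
    apply antitoneOn_of_deriv_nonpos (convex_Icc _ _) (hcont _)
    · intro x hx
      exact (hder _ x (hsub x (interior_subset hx))).differentiableAt.differentiableWithinAt
    · intro x hx
      rw [(hder _ x (hsub x (interior_subset hx))).deriv]
      have : - 2 * u x * w x - 1 * (u x ^ 2 + w x ^ 2) ≤ 0 := by nlinarith [sq_nonneg (u x + w x)]
      apply mul_nonpos_of_nonneg_of_nonpos (by positivity)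
      exact div_nonpos_of_nonpos_of_nonneg this (by positivity)
  have m1 := hmono ⟨le_rfl, h2⟩ ⟨h2, le_rfl⟩ h2
  have m2 := hanti ⟨le_rfl, h2⟩ ⟨h2, le_rfl⟩ h2
  simp only [Real.cos_pi_div_two, zero_div, mul_zero, Real.exp_zero, mul_one, one_mul, neg_mul] at m1 m2
  set t := Real.cos φ / Real.sin φ / (4 * lam) with ht
  have hs := sin_lower hφ0 h2
  have hs0 : 0 < Real.sin φ := by linarith
  have hc0 : 0 ≤ Real.cos φ := Real.cos_nonneg_of_mem_Icc ⟨by linarith, h2⟩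
  have ht0 : 0 ≤ t := by positivity
  have ht1 : t ≤ 1 / (2 * (lam * φ)) := by
    rw [ht, div_div, div_le_div_iff₀ (by positivity) (by positivity)]
    have := Real.cos_le_one φ
    have : Real.cos φ * (2 * (lam * φ)) ≤ 1 * (2 * (lam * φ)) := by gcongr
    nlinarith
  have hlp : 1 ≤ lam * φ := by
    rw [div_le_iff₀ hl0] at h1; linarith
  have ht2 : t ≤ 1 := ht1.trans (by rw [div_le_one (by positivity)]; linarith)
  have e1 := (abs_le.1 (Real.abs_exp_sub_one_le (x := t) (by rwa [abs_of_nonneg ht0]))).2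
  rw [abs_of_nonneg ht0] at e1
  have e2 : 1 - t ≤ Real.exp (-t) := by linarith [Real.add_one_le_exp (-t)]
  have hr : 0 ≤ ρ φ := by simp only [hρ]; positivity
  have hr0 : 0 ≤ ρ (π/2) := by simp only [hρ]; positivity
  have hee : Real.exp t * Real.exp (-t) = 1 := by rw [← Real.exp_add]; simp
  have k1 : ρ φ ≤ ρ (π/2) * Real.exp t := by
    have := mul_le_mul_of_nonneg_right m1 (Real.exp_pos t).le
    calc ρ φ = ρ φ * Real.exp (-t) * Real.exp t := by rw [mul_assoc, mul_comm (Real.exp (-t)), hee, mul_one]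
      _ ≤ _ := this
  have k2 : ρ (π/2) * Real.exp (-t) ≤ ρ φ := by
    have := mul_le_mul_of_nonneg_right m2 (Real.exp_pos (-t)).le
    calc _ ≤ _ := this
      _ = ρ φ := by rw [mul_assoc, hee, mul_one]
  have k3 : ρ (π/2) / (lam * φ) = 2 * (ρ (π/2) * (1 / (2 * (lam * φ)))) := by field_simp
  change |ρ φ - ρ (π/2)| ≤ ρ (π/2) / (lam * φ)
  rw [k3]
  have k4 : ρ (π/2) * t ≤ ρ (π/2) * (1 / (2 * (lam * φ))) := by gcongr
  have k5 : ρ (π/2) * (Real.exp t - 1) ≤ ρ (π/2) * (2 * t) := by gcongr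
  have k6 : ρ (π/2) * (1 - t) ≤ ρ (π/2) * Real.exp (-t) := by gcongr
  have k7 : 0 ≤ ρ (π/2) * t := by positivity
  rw [abs_le]; constructor <;> nlinarith

lemma inv_sin_sub {x : ℝ} (h0 : 0 < x) (h1 : x ≤ π / 2) : |1 / Real.sin x - 1 / x| ≤ 2 := by
  have hs := sin_lower h0 h1
  have hs0 : 0 < Real.sin x := by linarith
  have h3 := (Real.sin_lt h0).le
  rw [abs_le]
  constructor
  · have := one_div_le_one_div_of_le hs0 h3
    linarith
  · rcases le_total x 1 with h | h
    · have := Real.sin_gt_sub_cube h0 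
      rw [div_sub_div _ _ hs0.ne' h0.ne', div_le_iff₀ (by positivity)]
      nlinarith [mul_pos h0 h0, mul_pos (mul_pos h0 h0) h0]
    · have : 1 / Real.sin x ≤ 2 := by
        rw [div_le_iff₀ hs0]; linarith
      have : 0 < 1 / x := by positivity
      linarith

set_option maxHeartbeats 4000000 in
lemma core (lam : ℝ) (hl : 1 ≤ lam) (u w : ℝ → ℝ)
    (hu : ∀ φ ∈ Set.Ioo 0 π, HasDerivAt u (lam * w φ) φ)
    (hw : ∀ φ ∈ Set.Ioo 0 π, HasDerivAt w (-lam * u φ - u φ / (4 * lam * Real.sin φ ^ 2)) φ)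
    (ρ0 : ℝ) (hρ0 : ρ0 = u (π/2) ^ 2 + w (π/2) ^ 2)
    (a b : ℝ) (ha : |a| ≤ 1) (hb : |b| ≤ 1) (K M : ℝ) (hM : 0 ≤ M) (hK : 0 ≤ K)
    (f : ℝ → ℝ) (hf : Continuous f)
    (hfX : ∀ φ ∈ Set.Icc (1/lam) (π/2),
      |f φ - M * ((a * (3 * u φ ^ 2 * w φ ^ 2 - u φ ^ 4) + b * (w φ ^ 4 - 3 * u φ ^ 2 * w φ ^ 2)
        + 3 / 8 * (u φ ^ 2 + w φ ^ 2) ^ 2) / Real.sin φ)| ≤ K * M * ρ0 ^ 2 / (lam * φ ^ 2)) :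
    |(∫ φ in (1/lam)..(π/2), f φ) - M * (3 / 8 * ρ0 ^ 2 * Real.log lam)|
      ≤ (K + 200) * (M * ρ0 ^ 2) := by
  have hl0 : 0 < lam := by linarith
  have hpi := Real.pi_pos
  have hpi3 := Real.pi_gt_three
  have hpi4 := Real.pi_le_four
  have hr0 : 0 ≤ ρ0 := by rw [hρ0]; positivity
  have hil : 1 / lam ≤ 1 := by rw [div_le_one hl0]; exact hl
  have hil0 : 0 < 1 / lam := by positivity
  have hab : 1 / lam ≤ π / 2 := by linarith
  have hsub : ∀ x ∈ Set.Icc (1/lam) (π/2), x ∈ Set.Ioo 0 π := fun x hx =>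
    ⟨lt_of_lt_of_le hil0 hx.1, by linarith [hx.2]⟩
  -- bounds
  have hbd : ∀ x ∈ Set.Icc (1/lam) (π/2), |u x ^ 3 * w x| ≤ 4 * ρ0 ^ 2 ∧ |u x * w x ^ 3| ≤ 4 * ρ0 ^ 2
      ∧ u x ^ 4 ≤ 4 * ρ0 ^ 2 ∧ u x ^ 2 * w x ^ 2 ≤ 4 * ρ0 ^ 2 := by
    intro x hx
    have g := gron lam hl u w hu hw x hx.1 hx.2
    rw [← hρ0] at g
    have hlp : 1 ≤ lam * x := by
      have := hx.1
      rw [div_le_iff₀ hl0] at this; linarith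
    have g2 : u x ^ 2 + w x ^ 2 ≤ 2 * ρ0 := by
      have := (abs_le.1 g).2
      have : ρ0 / (lam * x) ≤ ρ0 := div_le_self hr0 hlp
      linarith
    have g3 : (u x ^ 2 + w x ^ 2) ^ 2 ≤ 4 * ρ0 ^ 2 := by
      have : (u x ^ 2 + w x ^ 2) ^ 2 ≤ (2 * ρ0) ^ 2 := by gcongr
      linarith
    have q1 : |u x * w x| ≤ u x ^ 2 + w x ^ 2 := by
      rw [abs_le]; constructor <;> nlinarith [sq_nonneg (u x - w x), sq_nonneg (u x + w x)]
    refine ⟨?_, ?_, ?_, ?_⟩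
    · rw [show u x ^ 3 * w x = u x ^ 2 * (u x * w x) by ring, abs_mul, abs_of_nonneg (sq_nonneg (u x))]
      refine le_trans ?_ g3
      rw [sq (u x ^ 2 + w x ^ 2)]
      gcongr
      linarith [sq_nonneg (w x)]
    · rw [show u x * w x ^ 3 = w x ^ 2 * (u x * w x) by ring, abs_mul, abs_of_nonneg (sq_nonneg (w x))]
      refine le_trans ?_ g3
      rw [sq (u x ^ 2 + w x ^ 2)]
      gcongr
      linarith [sq_nonneg (u x)]
    · nlinarith [sq_nonneg (u x), sq_nonneg (w x), mul_nonneg (sq_nonneg (u x)) (sq_nonneg (w x)), sq_nonneg (w x ^ 2)]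
    · nlinarith [sq_nonneg (u x), sq_nonneg (w x), mul_nonneg (sq_nonneg (u x)) (sq_nonneg (w x)), sq_nonneg (w x ^ 2), sq_nonneg (u x ^ 2)]
  set h : ℝ → ℝ := fun x => (a * (u x ^ 3 * w x) + b * (u x * w x ^ 3)) / (lam * Real.sin x) with hh
  set h' : ℝ → ℝ := fun x => (a * (3 * u x ^ 2 * w x ^ 2 - u x ^ 4) + b * (w x ^ 4 - 3 * u x ^ 2 * w x ^ 2)) / Real.sin x - (a * u x ^ 4 + 3 * b * (u x ^ 2 * w x ^ 2)) / (4 * lam ^ 2 * Real.sin x ^ 3) - (a * (u x ^ 3 * w x) + b * (u x * w x ^ 3)) * Real.cos x / (lam * Real.sin x ^ 2) with hh'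
  have hder : ∀ x ∈ Set.Icc (1/lam) (π/2), HasDerivAt h (h' x) x := by
    intro x hx
    have hs : 0 < Real.sin x := Real.sin_pos_of_mem_Ioo (hsub x hx)
    have du := hu x (hsub x hx)
    have dw := hw x (hsub x hx)
    have d := ((((du.pow 3).mul dw).const_mul a).add ((du.mul (dw.pow 3)).const_mul b)).div
      ((Real.hasDerivAt_sin x).const_mul lam) (by positivity)
    refine d.congr_deriv ?_
    simp only [hh', Pi.add_apply, Pi.pow_apply, Pi.mul_apply]
    field_simp
    ring
  have hcu : ContinuousOn u (Set.Icc (1/lam) (π/2)) := fun x hx =>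
    (hu x (hsub x hx)).continuousAt.continuousWithinAt
  have hcw : ContinuousOn w (Set.Icc (1/lam) (π/2)) := fun x hx =>
    (hw x (hsub x hx)).continuousAt.continuousWithinAt
  have hsne : ∀ x ∈ Set.Icc (1/lam) (π/2), Real.sin x ≠ 0 := fun x hx =>
    (Real.sin_pos_of_mem_Ioo (hsub x hx)).ne'
  have hch : ContinuousOn h' (Set.Icc (1/lam) (π/2)) := by
    have hsc : ContinuousOn Real.sin (Set.Icc (1/lam) (π/2)) := Real.continuous_sin.continuousOn
    have hcc : ContinuousOn Real.cos (Set.Icc (1/lam) (π/2)) := Real.continuous_cos.continuousOn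
    simp only [hh']
    refine ContinuousOn.sub (ContinuousOn.sub (ContinuousOn.div ?_ hsc hsne) (ContinuousOn.div ?_ ?_ ?_)) (ContinuousOn.div ?_ ?_ ?_)
    · fun_prop
    · fun_prop
    · fun_prop
    · intro x hx
      have := hsne x hx
      positivity
    · fun_prop
    · fun_prop
    · intro x hx
      have := hsne x hx
      positivity
  have hint : IntervalIntegrable h' MeasureTheory.volume (1/lam) (π/2) :=
    ContinuousOn.intervalIntegrable (by rwa [Set.uIcc_of_le hab])
  have hftc : ∫ x in (1/lam)..(π/2), h' x = h (π/2) - h (1/lam) :=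
    intervalIntegral.integral_eq_sub_of_hasDerivAt (by rw [Set.uIcc_of_le hab]; exact hder) hint
  have hne : ∀ x ∈ Set.uIcc (1/lam) (π/2), x ≠ 0 := by
    rw [Set.uIcc_of_le hab]; exact fun x hx => (hsub x hx).1.ne'
  have hi1 : IntervalIntegrable (fun x : ℝ => 1 / x) MeasureTheory.volume (1/lam) (π/2) :=
    ContinuousOn.intervalIntegrable (continuousOn_const.div continuousOn_id hne)
  have hi2 : IntervalIntegrable (fun x : ℝ => 1 / x ^ 2) MeasureTheory.volume (1/lam) (π/2) :=
    ContinuousOn.intervalIntegrable (continuousOn_const.div (continuousOn_id.pow 2) (fun x hx => pow_ne_zero _ (hne x hx)))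
  have hI2 : ∫ x in (1/lam)..(π/2), 1 / x ^ 2 = lam - 2 / π := by
    have : ∀ x ∈ Set.uIcc (1/lam) (π/2), HasDerivAt (fun x : ℝ => - x⁻¹) (1 / x ^ 2) x := by
      intro x hx
      refine (hasDerivAt_inv (hne x hx)).neg.congr_deriv ?_
      simp
    rw [intervalIntegral.integral_eq_sub_of_hasDerivAt this hi2]
    simp; ring
  have hI1 : ∫ x in (1/lam)..(π/2), 1 / x = Real.log (π/2) + Real.log lam := by
    rw [integral_one_div_of_pos hil0 (by positivity), ← Real.log_mul (by positivity) (by positivity)]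
    congr 1; field_simp
  -- main pointwise bound
  have key : ∀ x ∈ Set.Icc (1/lam) (π/2),
      |f x - M * (3 / 8 * ρ0 ^ 2 * (1 / x)) - M * h' x| ≤ M * ρ0 ^ 2 * ((K + 70) / lam * (1 / x ^ 2) + 1) := by
    intro x hx
    have hx0 : 0 < x := (hsub x hx).1
    have hs2 := sin_lower hx0 hx.2
    have hs : 0 < Real.sin x := by linarith
    have hlp : 1 ≤ lam * x := by
      have := hx.1
      rw [div_le_iff₀ hl0] at this; linarith
    obtain ⟨b1, b2, b3, b4⟩ := hbd x hx
    have g := gron lam hl u w hu hw x hx.1 hx.2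
    rw [← hρ0] at g
    have is := inv_sin_sub hx0 hx.2
    have f1 := hfX x hx
    set ρ := u x ^ 2 + w x ^ 2 with hρ
    have hρ' : 0 ≤ ρ := by positivity
    have hdec : f x - M * (3 / 8 * ρ0 ^ 2 * (1 / x)) - M * h' x =
      (f x - M * ((a * (3 * u x ^ 2 * w x ^ 2 - u x ^ 4) + b * (w x ^ 4 - 3 * u x ^ 2 * w x ^ 2)
        + 3 / 8 * ρ ^ 2) / Real.sin x)) + M * (3 / 8 * ((ρ - ρ0) * (ρ + ρ0)) / Real.sin x)
       + M * (3 / 8 * ρ0 ^ 2 * (1 / Real.sin x - 1 / x))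
       + M * ((a * u x ^ 4 + 3 * (b * (u x ^ 2 * w x ^ 2))) / (4 * lam ^ 2 * Real.sin x ^ 3))
       + M * ((a * (u x ^ 3 * w x) + b * (u x * w x ^ 3)) * Real.cos x / (lam * Real.sin x ^ 2)) := by
      simp only [hh']
      field_simp
      ring
    rw [hdec]
    have T2 : |M * (3 / 8 * ((ρ - ρ0) * (ρ + ρ0)) / Real.sin x)| ≤ M * ρ0 ^ 2 * (3 / (lam * x ^ 2)) := by
      rw [abs_mul, abs_of_nonneg hM, mul_assoc M]
      gcongr
      rw [abs_div, abs_mul, abs_mul, abs_of_pos hs, abs_of_nonneg (by positivity : 0 ≤ ρ + ρ0), abs_of_pos (by norm_num : (0:ℝ) < 3/8)]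
      have : ρ0 / (lam * x) ≤ ρ0 := div_le_self hr0 hlp
      have h3 : ρ + ρ0 ≤ 3 * ρ0 := by linarith [(abs_le.1 g).2]
      calc 3 / 8 * (|ρ - ρ0| * (ρ + ρ0)) / Real.sin x ≤ 3 / 8 * (ρ0 / (lam * x) * (3 * ρ0)) / (x / 2) := by gcongr
        _ = ρ0 ^ 2 * ((9/4) / (lam * x ^ 2)) := by field_simp; ring
        _ ≤ _ := by gcongr; norm_num
    have T3 : |M * (3 / 8 * ρ0 ^ 2 * (1 / Real.sin x - 1 / x))| ≤ M * ρ0 ^ 2 := by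
      rw [abs_mul, abs_of_nonneg hM]
      gcongr
      rw [abs_mul, abs_of_nonneg (by positivity : 0 ≤ 3 / 8 * ρ0 ^ 2)]
      calc 3 / 8 * ρ0 ^ 2 * |1 / Real.sin x - 1 / x| ≤ 3 / 8 * ρ0 ^ 2 * 2 := by gcongr
        _ ≤ _ := by nlinarith [sq_nonneg ρ0]
    have T4 : |M * ((a * u x ^ 4 + 3 * (b * (u x ^ 2 * w x ^ 2))) / (4 * lam ^ 2 * Real.sin x ^ 3))| ≤ M * ρ0 ^ 2 * (32 / (lam * x ^ 2)) := by
      rw [abs_mul, abs_of_nonneg hM, mul_assoc M]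
      gcongr
      rw [abs_div, abs_of_pos (by positivity : 0 < 4 * lam ^ 2 * Real.sin x ^ 3)]
      have c1 : |a * u x ^ 4| ≤ 1 * (4 * ρ0 ^ 2) := by
        rw [abs_mul]
        have : |u x ^ 4| ≤ 4 * ρ0 ^ 2 := by rwa [abs_of_nonneg (by positivity)]
        gcongr
      have c2 : |b * (u x ^ 2 * w x ^ 2)| ≤ 1 * (4 * ρ0 ^ 2) := by
        rw [abs_mul]
        have : |u x ^ 2 * w x ^ 2| ≤ 4 * ρ0 ^ 2 := by rwa [abs_of_nonneg (by positivity)]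
        gcongr
      have c3 : |a * u x ^ 4 + 3 * (b * (u x ^ 2 * w x ^ 2))| ≤ 16 * ρ0 ^ 2 := by
        rw [abs_le] at *; constructor <;> linarith [c1.1, c1.2, c2.1, c2.2]
      calc |a * u x ^ 4 + 3 * (b * (u x ^ 2 * w x ^ 2))| / (4 * lam ^ 2 * Real.sin x ^ 3)
          ≤ (16 * ρ0 ^ 2) / (4 * lam ^ 2 * (x / 2) ^ 3) := by gcongr
        _ = ρ0 ^ 2 * (32 / (lam * x ^ 2)) / (lam * x) := by field_simp; ring
        _ ≤ _ := div_le_self (by positivity) hlp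
    have T5 : |M * ((a * (u x ^ 3 * w x) + b * (u x * w x ^ 3)) * Real.cos x / (lam * Real.sin x ^ 2))| ≤ M * ρ0 ^ 2 * (32 / (lam * x ^ 2)) := by
      rw [abs_mul, abs_of_nonneg hM, mul_assoc M]
      gcongr
      rw [abs_div, abs_mul, abs_of_pos (by positivity : 0 < lam * Real.sin x ^ 2)]
      have c1 : |a * (u x ^ 3 * w x)| ≤ 1 * (4 * ρ0 ^ 2) := by
        rw [abs_mul]; gcongr
      have c2 : |b * (u x * w x ^ 3)| ≤ 1 * (4 * ρ0 ^ 2) := by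
        rw [abs_mul]; gcongr
      have c3 : |a * (u x ^ 3 * w x) + b * (u x * w x ^ 3)| ≤ 8 * ρ0 ^ 2 := by
        rw [abs_le] at *; constructor <;> linarith [c1.1, c1.2, c2.1, c2.2]
      have c4 := Real.abs_cos_le_one x
      calc |a * (u x ^ 3 * w x) + b * (u x * w x ^ 3)| * |Real.cos x| / (lam * Real.sin x ^ 2)
          ≤ (8 * ρ0 ^ 2) * 1 / (lam * (x / 2) ^ 2) := by gcongr
        _ = _ := by field_simp; ring
    have T : M * ρ0 ^ 2 * ((K + 70) / lam * (1 / x ^ 2) + 1) = K * M * ρ0 ^ 2 / (lam * x ^ 2) +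
        (M * ρ0 ^ 2 * (3 / (lam * x ^ 2)) + M * ρ0 ^ 2 + M * ρ0 ^ 2 * (32 / (lam * x ^ 2)) + M * ρ0 ^ 2 * (32 / (lam * x ^ 2)))
        + M * ρ0 ^ 2 * (3 / (lam * x ^ 2)) := by
      field_simp; ring
    have T6 : 0 ≤ M * ρ0 ^ 2 * (3 / (lam * x ^ 2)) := by positivity
    rw [T]
    simp only [abs_le] at *
    constructor <;> linarith [f1.1, f1.2, T2.1, T2.2, T3.1, T3.2, T4.1, T4.2, T5.1, T5.2]
  have hif : IntervalIntegrable f MeasureTheory.volume (1/lam) (π/2) := hf.intervalIntegrable _ _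
  have hib : IntervalIntegrable (fun x => M * ρ0 ^ 2 * ((K + 70) / lam * (1 / x ^ 2) + 1)) MeasureTheory.volume (1/lam) (π/2) :=
    ((hi2.const_mul _).add intervalIntegrable_const).const_mul _
  have N := intervalIntegral.norm_integral_le_of_norm_le hab
    (f := fun x => f x - M * (3 / 8 * ρ0 ^ 2 * (1 / x)) - M * h' x)
    (g := fun x => M * ρ0 ^ 2 * ((K + 70) / lam * (1 / x ^ 2) + 1))
    (Filter.Eventually.of_forall (fun x hx => by
      rw [Real.norm_eq_abs]; exact key x ⟨hx.1.le, hx.2⟩)) hib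
  rw [intervalIntegral.integral_sub (hif.sub ((hi1.const_mul _).const_mul _)) (hint.const_mul _),
    intervalIntegral.integral_sub hif ((hi1.const_mul _).const_mul _),
    intervalIntegral.integral_const_mul, intervalIntegral.integral_const_mul, hI1,
    intervalIntegral.integral_const_mul, hftc, intervalIntegral.integral_const_mul,
    intervalIntegral.integral_add (hi2.const_mul _) intervalIntegrable_const,
    intervalIntegral.integral_const_mul, hI2, intervalIntegral.integral_const, Real.norm_eq_abs] at N
  have hB : ∀ x ∈ Set.Icc (1/lam) (π/2), |h x| ≤ 16 * ρ0 ^ 2 := by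
    intro x hx
    have hx0 : 0 < x := (hsub x hx).1
    have hs2 := sin_lower hx0 hx.2
    have hs : 0 < Real.sin x := by linarith
    have hlp : 1 ≤ lam * x := by
      have := hx.1
      rw [div_le_iff₀ hl0] at this; linarith
    obtain ⟨b1, b2, b3, b4⟩ := hbd x hx
    simp only [hh]
    rw [abs_div, abs_of_pos (by positivity : 0 < lam * Real.sin x), div_le_iff₀ (by positivity)]
    have c1 : |a * (u x ^ 3 * w x)| ≤ 1 * (4 * ρ0 ^ 2) := by
      rw [abs_mul]; gcongr
    have c2 : |b * (u x * w x ^ 3)| ≤ 1 * (4 * ρ0 ^ 2) := by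
      rw [abs_mul]; gcongr
    have c3 : |a * (u x ^ 3 * w x) + b * (u x * w x ^ 3)| ≤ 8 * ρ0 ^ 2 := by
      rw [abs_le] at *; constructor <;> linarith [c1.1, c1.2, c2.1, c2.2]
    have : 1 / 2 ≤ lam * Real.sin x := by nlinarith
    nlinarith [sq_nonneg ρ0]
  have B1 := hB (1/lam) ⟨le_rfl, hab⟩
  have B2 := hB (π/2) ⟨hab, le_rfl⟩
  have L1 : Real.log (π/2) ≤ 1 := by
    have := Real.log_le_sub_one_of_pos (x := π/2) (by positivity); linarith
  have L0 : 0 ≤ Real.log (π/2) := Real.log_nonneg (by linarith)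
  have R : M * ρ0 ^ 2 * ((K + 70) / lam * (lam - 2 / π) + (π / 2 - 1 / lam) • (1:ℝ)) ≤ M * ρ0 ^ 2 * (K + 72) := by
    refine mul_le_mul_of_nonneg_left ?_ (by positivity)
    have : (K + 70) / lam * (lam - 2 / π) ≤ (K + 70) / lam * lam := by
      gcongr
      have : 0 < 2 / π := by positivity
      linarith
    rw [div_mul_cancel₀ _ hl0.ne'] at this
    rw [smul_eq_mul, mul_one]
    linarith
  have Q1 : |M * (h (π/2) - h (1/lam))| ≤ M * (32 * ρ0 ^ 2) := by
    rw [abs_mul, abs_of_nonneg hM]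
    gcongr
    rw [abs_le] at *; constructor <;> linarith [B1.1, B1.2, B2.1, B2.2]
  have Q2 : |M * (3 / 8 * ρ0 ^ 2 * Real.log (π/2))| ≤ M * (3 / 8 * ρ0 ^ 2 * 1) := by
    rw [abs_of_nonneg (by positivity)]
    gcongr
  have Q3 : 0 ≤ M * ρ0 ^ 2 := by positivity
  have N' := N.trans R
  rw [abs_le] at *
  constructor <;> nlinarith [N'.1, N'.2, Q1.1, Q1.2, Q2.1, Q2.2]
open Polynomial in
lemma iteratedDeriv_eval (p : ℝ[X]) (n : ℕ) :
    iteratedDeriv n (fun x => p.eval x) = fun x => (derivative^[n] p).eval x := by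
  induction n with
  | zero => simp
  | succ n ih =>
    rw [iteratedDeriv_succ, ih]
    funext x
    rw [Polynomial.deriv, Function.iterate_succ_apply']

open Polynomial in
noncomputable def legPoly (l : ℕ) : ℝ[X] :=
  C (1 / (2 ^ l * (Nat.factorial l : ℝ))) * derivative^[l] ((X ^ 2 - 1) ^ l)

lemma legendreP_eq (l : ℕ) : legendreP l = fun x => (legPoly l).eval x := by
  funext x
  have := iteratedDeriv_eval ((Polynomial.X ^ 2 - 1) ^ l) l
  simp only [Polynomial.eval_pow, Polynomial.eval_sub, Polynomial.eval_X, Polynomial.eval_one] at this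
  rw [legendreP, this, legPoly, Polynomial.eval_mul, Polynomial.eval_C]

open Polynomial in
lemma rod_ode (l k : ℕ) :
    ((X : ℝ[X]) ^ 2 - 1) * derivative^[k + 2] ((X ^ 2 - 1) ^ l)
      + C (2 * ((k:ℝ) + 1) - 2 * l) * X * derivative^[k + 1] ((X ^ 2 - 1) ^ l)
      + C (((k:ℝ) + 1) * k - 2 * l * (k + 1)) * derivative^[k] ((X ^ 2 - 1) ^ l) = 0 := by
  induction k with
  | zero =>
    have h0 : ((X : ℝ[X]) ^ 2 - 1) * derivative ((X ^ 2 - 1) ^ l) = C (2 * (l:ℝ)) * X * (X ^ 2 - 1) ^ l := by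
      cases l with
      | zero => simp
      | succ l =>
        rw [derivative_pow]
        simp [show (C (2:ℝ)) = 2 from rfl]
        ring
    have h1 := congrArg derivative h0
    simp only [derivative_mul, derivative_sub, derivative_X_sq, derivative_one, derivative_C, derivative_X] at h1
    simp only [Function.iterate_succ_apply', Function.iterate_zero_apply] at *
    simp only [map_mul, map_sub, map_add, map_ofNat, map_natCast, map_one, map_zero, Nat.cast_zero] at *
    linear_combination h1
  | succ k ih =>
    have h1 := congrArg derivative ih
    simp only [derivative_mul, derivative_add, derivative_sub, derivative_X_sq, derivative_one, derivative_C, derivative_X, derivative_zero, ← Function.iterate_succ_apply'] at h1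
    push_cast
    simp only [map_mul, map_sub, map_add, map_ofNat, map_natCast, map_one, map_zero, Nat.cast_zero] at *
    simp only [Nat.succ_eq_add_one, show k + 1 + 2 = k + 2 + 1 by ring, show k + 1 + 1 = k + 2 by ring] at *
    linear_combination h1

open Polynomial in
lemma leg_ode (l : ℕ) (x : ℝ) :
    (x ^ 2 - 1) * (derivative (derivative (legPoly l))).eval x + 2 * x * (derivative (legPoly l)).eval x
      - l * (l + 1) * (legPoly l).eval x = 0 := by
  have h := congrArg (Polynomial.eval x) (rod_ode l l)
  simp only [legPoly, derivative_C_mul, ← Function.iterate_succ_apply' derivative]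
  simp only [eval_add, eval_mul, eval_sub, eval_pow, eval_X, eval_one, eval_C, eval_zero, Nat.succ_eq_add_one] at *
  linear_combination (1 / (2 ^ l * (Nat.factorial l : ℝ))) * h

open Polynomial in
lemma leg_one (l : ℕ) : (legPoly l).eval 1 = 1 := by
  have h : (derivative^[l] (((X:ℝ[X]) ^ 2 - 1) ^ l)).eval 1 = (l.factorial : ℝ) * (2:ℝ) ^ l := by
    rw [← factorial_smul_hasseDeriv]
    simp only [LinearMap.smul_apply, eval_smul]
    rw [← taylor_coeff, show taylor (1:ℝ) ((X ^ 2 - 1) ^ l) = (taylor (1:ℝ) (X ^ 2 - 1)) ^ l from taylor_pow _ _ _]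
    have : taylor (1:ℝ) (X ^ 2 - 1) = (X + C 2) * X := by
      rw [map_sub, taylor_X_pow, taylor_one]
      rw [show (C (2:ℝ)) = 2 from rfl]; simp; ring
    rw [this, mul_pow, coeff_mul_X_pow', if_pos le_rfl, Nat.sub_self, coeff_zero_eq_eval_zero]
    simp
  rw [legPoly, eval_mul, h, eval_C]
  have : (l.factorial : ℝ) ≠ 0 := by positivity
  field_simp

open Polynomial in
lemma eval0_iter (p : ℝ[X]) (k : ℕ) : (derivative^[k] p).eval 0 = (k.factorial : ℝ) * p.coeff k := by
  rw [← coeff_zero_eq_eval_zero, coeff_iterate_derivative]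
  simp [Nat.descFactorial_self]

open Polynomial in
lemma coeff_even (l m : ℕ) : ((((X:ℝ[X]) ^ 2 - 1) ^ l).coeff (2 * m)) = (-1:ℝ) ^ (l - m) * (l.choose m : ℝ) := by
  have : ((X:ℝ[X]) ^ 2 - 1) ^ l = expand ℝ 2 ((X + C (-1)) ^ l) := by
    simp [sub_eq_add_neg]
  rw [this, mul_comm 2 m, coeff_expand_mul (by norm_num), coeff_X_add_C_pow]

open Polynomial in
lemma coeff_odd (l m : ℕ) : ((((X:ℝ[X]) ^ 2 - 1) ^ l).coeff (2 * m + 1)) = 0 := by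
  have : ((X:ℝ[X]) ^ 2 - 1) ^ l = expand ℝ 2 ((X + C (-1)) ^ l) := by
    simp [sub_eq_add_neg]
  rw [this, coeff_expand (by norm_num), if_neg (by omega)]

/-- Square of the normalized central binomial coefficient. -/
lemma wallis (n : ℕ) : 2 / (π * (2 * n + 1)) ≤ (((2 * n).choose n : ℝ) / 4 ^ n) ^ 2 ∧
    (((2 * n).choose n : ℝ) / 4 ^ n) ^ 2 ≤ 2 * (2 * n + 2) / (π * (2 * n + 1) ^ 2) := by
  have hW := Real.Wallis.W_eq_factorial_ratio n
  have h1 := Real.Wallis.W_le n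
  have h2 := Real.Wallis.le_W n
  have h0 := Real.Wallis.W_pos n
  have hpi := Real.pi_pos
  have e : (((2 * n).choose n : ℝ) / 4 ^ n) ^ 2 = 1 / ((2 * n + 1) * Real.Wallis.W n) := by
    rw [hW]
    have hc : ((2 * n).choose n : ℝ) = (2 * n).factorial / (n.factorial * n.factorial) := by
      rw [Nat.cast_choose ℝ (by omega), show 2 * n - n = n by omega]
    rw [hc, show (4:ℝ) = 2 ^ 2 by norm_num]
    have : ((2*n).factorial : ℝ) ≠ 0 := by positivity
    have : (n.factorial : ℝ) ≠ 0 := by positivity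
    field_simp
    ring_nf
    rw [show (4:ℝ) = 2 ^ 2 by norm_num, ← pow_mul]; ring_nf
  rw [e]
  constructor
  · rw [div_le_div_iff₀ (by positivity) (by positivity)]
    nlinarith [mul_le_mul_of_nonneg_left h1 (by positivity : (0:ℝ) ≤ 2 * n + 1)]
  · rw [div_le_div_iff₀ (by positivity) (by positivity)]
    rw [div_mul_eq_mul_div, div_le_iff₀ (by positivity)] at h2
    nlinarith [mul_le_mul_of_nonneg_left h2 (by positivity : (0:ℝ) ≤ 2 * n + 1)]

open Polynomial in
lemma rho_bound (l : ℕ) (hl : 1 ≤ l) :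
    |(l:ℝ) * ((legPoly l).eval 0 ^ 2 + ((derivative (legPoly l)).eval 0 / ((l:ℝ) + 1/2)) ^ 2) * (π / 2) - 1|
      ≤ 4 / (l:ℝ) := by
  have hpi := Real.pi_pos
  have d0 : (legPoly l).eval 0 = (((X:ℝ[X]) ^ 2 - 1) ^ l).coeff l / 2 ^ l := by
    rw [legPoly, eval_mul, eval_C, eval0_iter]
    have : (l.factorial : ℝ) ≠ 0 := by positivity
    field_simp
  have d1 : (derivative (legPoly l)).eval 0 = ((l:ℝ) + 1) * (((X:ℝ[X]) ^ 2 - 1) ^ l).coeff (l + 1) / 2 ^ l := by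
    rw [legPoly, derivative_C_mul, ← Function.iterate_succ_apply' derivative, eval_mul, eval_C, eval0_iter]
    have : (l.factorial : ℝ) ≠ 0 := by positivity
    rw [Nat.succ_eq_add_one, Nat.factorial_succ]
    push_cast
    field_simp
  rw [d0, d1]
  rcases Nat.even_or_odd' l with ⟨n, rfl | rfl⟩
  · have hn : (1:ℝ) ≤ n := by exact_mod_cast (by omega : 1 ≤ n)
    rw [coeff_odd, coeff_even]
    obtain ⟨w1, w2⟩ := wallis n
    have e : ((-1) ^ (2 * n - n) * ((2 * n).choose n : ℝ) / 2 ^ (2 * n)) ^ 2 = (((2 * n).choose n : ℝ) / 4 ^ n) ^ 2 := by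
      rw [mul_div_assoc, mul_pow, ← pow_mul, mul_comm (2 * n - n) 2, pow_mul (-1:ℝ)]
      rw [pow_mul (2:ℝ)]; norm_num
    rw [e]
    set c := (((2 * n).choose n : ℝ) / 4 ^ n) ^ 2
    rw [div_le_iff₀ (by positivity)] at w1
    rw [le_div_iff₀ (by positivity)] at w2
    push_cast
    rw [mul_zero, zero_div, zero_div, zero_pow (by norm_num), add_zero]
    have hz1 : 2 ≤ (c * π) * (2 * n + 1) := by linarith
    have hz2 : (c * π) * (2 * n + 1) ^ 2 ≤ 2 * (2 * n + 2) := by linarith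
    have hz0 : 0 ≤ c * π := by positivity
    rw [show (2 * (n:ℝ) * c * (π / 2) - 1) = n * (c * π) - 1 by ring]
    generalize c * π = z at *
    rw [abs_le, ← neg_div, div_le_iff₀ (by positivity), le_div_iff₀ (by positivity)]
    constructor
    · nlinarith
    · have : (n:ℝ) * z ≤ 1 := by nlinarith
      nlinarith
  · have hn : (0:ℝ) ≤ n := by positivity
    rw [coeff_odd, show 2 * n + 1 + 1 = 2 * (n + 1) by ring, coeff_even]
    obtain ⟨w1, w2⟩ := wallis (n + 1)
    have hcc : (2 * (n + 1)).choose (n + 1) = 2 * (2 * n + 1).choose (n + 1) := by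
      rw [show 2 * (n + 1) = (2 * n + 1) + 1 by ring, Nat.choose_succ_succ]
      have := Nat.choose_symm_half n
      simp only [Nat.succ_eq_add_one] at *
      omega
    have e : ((((2 * n + 1 : ℕ) : ℝ) + 1) * ((-1) ^ (2 * n + 1 - (n + 1)) * ((2 * n + 1).choose (n + 1) : ℝ)) / 2 ^ (2 * n + 1) / (((2 * n + 1 : ℕ) : ℝ) + 1/2)) ^ 2
        = (2 * (n + 1)) ^ 2 * (((2 * (n + 1)).choose (n + 1) : ℝ) / 4 ^ (n + 1)) ^ 2 / (2 * n + 3 / 2) ^ 2 := by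
      rw [hcc]
      have s : ∀ k : ℕ, ((-1:ℝ) ^ k) ^ 2 = 1 := by
        intro k
        rw [← pow_mul, mul_comm, pow_mul]; norm_num
      push_cast
      have : (4:ℝ) ^ (n + 1) = 2 * 2 ^ (2 * n + 1) := by
        rw [show (4:ℝ) = 2 ^ 2 by norm_num, ← pow_mul]; ring
      rw [this]
      simp only [div_pow, mul_pow, s]
      rw [show (2 * (n:ℝ) + 1 + 1 / 2) = 2 * n + 3 / 2 by ring, show (2 * (n:ℝ) + 1 + 1) = 2 * (n + 1) by ring]
      field_simp
    rw [e]
    set c := (((2 * (n + 1)).choose (n + 1) : ℝ) / 4 ^ (n + 1)) ^ 2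
    rw [div_le_iff₀ (by positivity)] at w1
    rw [le_div_iff₀ (by positivity)] at w2
    push_cast at *
    rw [zero_div, zero_pow (by norm_num), zero_add]
    have hz1 : 2 ≤ (c * π) * (2 * n + 3) := by linarith
    have hz2 : (c * π) * (2 * n + 3) ^ 2 ≤ 2 * (2 * n + 4) := by linarith
    have hz0 : 0 ≤ c * π := by positivity
    rw [show ((2 * (n:ℝ) + 1) * ((2 * (n + 1)) ^ 2 * c / (2 * n + 3 / 2) ^ 2) * (π / 2) - 1) = ((2 * (n:ℝ) + 1) * (2 * (n + 1) ^ 2) * (c * π) - (2 * n + 3 / 2) ^ 2) / (2 * n + 3 / 2) ^ 2 by field_simp]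
    generalize c * π = z at *
    rw [abs_div, abs_of_pos (by positivity : 0 < (2 * (n:ℝ) + 3 / 2) ^ 2), div_le_div_iff₀ (by positivity) (by positivity)]
    have hz3 : z ≤ 2 * (2 * n + 4) / (2 * n + 3) ^ 2 := by rwa [le_div_iff₀ (by positivity)]
    have hz4 : 2 / (2 * n + 3) ≤ z := by rwa [div_le_iff₀ (by positivity)]
    have hA : |(2 * (n:ℝ) + 1) * (2 * (n + 1) ^ 2) * z - (2 * n + 3 / 2) ^ 2| ≤ 4 * (n:ℝ) + 6 := by
      rw [abs_le]
      constructor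
      · have : (2 * (n:ℝ) + 1) * (2 * (n + 1) ^ 2) * (2 / (2 * n + 3)) ≤ (2 * (n:ℝ) + 1) * (2 * (n + 1) ^ 2) * z := by gcongr
        have h2 : (2 * n + 3 / 2) ^ 2 - (4 * n + 6) ≤ (2 * (n:ℝ) + 1) * (2 * (n + 1) ^ 2) * (2 / (2 * n + 3)) := by
          rw [mul_div_assoc', le_div_iff₀ (by positivity)]
          nlinarith
        linarith
      · have : (2 * (n:ℝ) + 1) * (2 * (n + 1) ^ 2) * z ≤ (2 * (n:ℝ) + 1) * (2 * (n + 1) ^ 2) * (2 * (2 * n + 4) / (2 * n + 3) ^ 2) := by gcongr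
        have h2 : (2 * (n:ℝ) + 1) * (2 * (n + 1) ^ 2) * (2 * (2 * n + 4) / (2 * n + 3) ^ 2) ≤ (2 * n + 3 / 2) ^ 2 + (4 * n + 6) := by
          rw [mul_div_assoc', div_le_iff₀ (by positivity)]
          nlinarith [mul_nonneg hn hn, mul_nonneg (mul_nonneg hn hn) hn, mul_nonneg (mul_nonneg hn hn) (mul_nonneg hn hn)]
        linarith
    calc _ ≤ (4 * (n:ℝ) + 6) * (2 * n + 1) := by gcongr
      _ ≤ _ := by nlinarith

open Polynomial in
lemma leg_bound (l : ℕ) (hl : 1 ≤ l) (x : ℝ) (h0 : 0 ≤ x) (h1 : x ≤ 1) :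
    |(legPoly l).eval x| ≤ 1 := by
  have hl' : (0:ℝ) < l := by exact_mod_cast hl
  set L : ℝ := l * (l + 1) with hL
  have hL0 : 0 < L := by positivity
  set p := legPoly l
  have hd : ∀ y, HasDerivAt (fun y => p.eval y ^ 2 + (1 - y ^ 2) * (derivative p).eval y ^ 2 / L)
      (2 * y * (derivative p).eval y ^ 2 / L) y := by
    intro y
    have d1 := p.hasDerivAt y
    have d2 := (derivative p).hasDerivAt y
    have d3 := ((hasDerivAt_id y).pow 2).const_sub 1
    refine ((d1.pow 2).add ((d3.mul (d2.pow 2)).div_const L)).congr_deriv ?_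
    have ode := leg_ode l y
    simp only [Pi.pow_apply, id]
    field_simp
    simp only [← hL] at ode
    linear_combination (-2) * eval y (derivative p) * ode
  have hm : MonotoneOn (fun y => p.eval y ^ 2 + (1 - y ^ 2) * (derivative p).eval y ^ 2 / L) (Set.Icc 0 1) := by
    apply monotoneOn_of_deriv_nonneg (convex_Icc _ _)
    · exact fun y _ => (hd y).continuousAt.continuousWithinAt
    · exact fun y _ => (hd y).differentiableAt.differentiableWithinAt
    · intro y hy
      rw [(hd y).deriv]
      have : 0 ≤ y := (interior_subset hy).1
      positivity
  have t := hm ⟨h0, h1⟩ ⟨zero_le_one, le_rfl⟩ h1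
  have l1 := leg_one l
  simp only [p, l1] at t
  norm_num at t
  rw [← sq_le_one_iff_abs_le_one]
  have : 0 ≤ (1 - x ^ 2) * (derivative p).eval x ^ 2 / L := by
    have : 0 ≤ 1 - x ^ 2 := by nlinarith
    positivity
  simp only [p] at *
  linarith

open Polynomial in
lemma leg_deriv_bound (l : ℕ) (hl : 1 ≤ l) (x : ℝ) (h0 : 0 ≤ x) (h1 : x < 1) :
    |(derivative (legPoly l)).eval x| ≤ l * (l + 1) := by
  have hl' : (0:ℝ) < l := by exact_mod_cast hl
  have hd : ∀ y, HasDerivAt (fun y => (1 - y ^ 2) * (derivative (legPoly l)).eval y)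
      (- (l * (l + 1) * (legPoly l).eval y)) y := by
    intro y
    have d2 := (derivative (legPoly l)).hasDerivAt y
    have d3 := ((hasDerivAt_id y).pow 2).const_sub 1
    refine (d3.mul d2).congr_deriv ?_
    have ode := leg_ode l y
    simp only [Pi.pow_apply, id]
    linear_combination (-1) * ode
  have := Convex.norm_image_sub_le_of_norm_hasDerivWithin_le (C := l * (l + 1)) (s := Set.Icc (0:ℝ) 1)
    (fun y hy => (hd y).hasDerivWithinAt) (fun y hy => by
      rw [norm_neg, norm_mul, Real.norm_eq_abs, Real.norm_eq_abs, abs_of_pos (by positivity)]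
      have := leg_bound l hl y hy.1 hy.2
      have h : (0:ℝ) < l * (l + 1) := by positivity
      nlinarith) (convex_Icc _ _) (⟨zero_le_one, le_rfl⟩ : (1:ℝ) ∈ Set.Icc (0:ℝ) 1) (⟨h0, h1.le⟩ : x ∈ Set.Icc (0:ℝ) 1)
  norm_num at this
  rw [abs_of_nonneg (by nlinarith : (0:ℝ) ≤ 1 - x^2), abs_of_nonpos (by linarith : x - 1 ≤ 0)] at this
  have h3 : (1 + x) * |(derivative (legPoly l)).eval x| ≤ l * (l + 1) := by
    have hx : 0 < 1 - x := by linarith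
    have : (1 - x) * ((1 + x) * |(derivative (legPoly l)).eval x|) ≤ (1 - x) * (l * (l + 1)) := by linarith
    exact le_of_mul_le_mul_left this hx
  nlinarith [abs_nonneg ((derivative (legPoly l)).eval x)]
open Polynomial in
noncomputable def uFun (l : ℕ) (φ : ℝ) : ℝ := √(Real.sin φ) * (legPoly l).eval (Real.cos φ)

open Polynomial in
noncomputable def wFun (l : ℕ) (φ : ℝ) : ℝ :=
  (√(Real.sin φ) * (-(Real.sin φ * (derivative (legPoly l)).eval (Real.cos φ)))
    + Real.cos φ * (legPoly l).eval (Real.cos φ) / (2 * √(Real.sin φ))) / ((l:ℝ) + 1 / 2)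

open Polynomial in
lemma uFun_deriv (l : ℕ) (φ : ℝ) (h : φ ∈ Set.Ioo 0 π) :
    HasDerivAt (uFun l) (((l:ℝ) + 1 / 2) * wFun l φ) φ := by
  have hs : 0 < Real.sin φ := Real.sin_pos_of_mem_Ioo h
  have hq : 0 < √(Real.sin φ) := Real.sqrt_pos.2 hs
  have d1 := (Real.hasDerivAt_sin φ).sqrt hs.ne'
  have d2 := ((legPoly l).hasDerivAt (Real.cos φ)).comp φ (Real.hasDerivAt_cos φ)
  refine (d1.mul d2).congr_deriv ?_
  simp only [wFun, Function.comp_apply]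
  field_simp
  ring

open Polynomial in
lemma wFun_deriv (l : ℕ) (φ : ℝ) (h : φ ∈ Set.Ioo 0 π) :
    HasDerivAt (wFun l) (-((l:ℝ) + 1 / 2) * uFun l φ
      - uFun l φ / (4 * ((l:ℝ) + 1 / 2) * Real.sin φ ^ 2)) φ := by
  have hs : 0 < Real.sin φ := Real.sin_pos_of_mem_Ioo h
  have hq : 0 < √(Real.sin φ) := Real.sqrt_pos.2 hs
  have hl : (0:ℝ) < (l:ℝ) + 1 / 2 := by positivity
  have d1 := (Real.hasDerivAt_sin φ).sqrt hs.ne'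
  have d2 := ((legPoly l).hasDerivAt (Real.cos φ)).comp φ (Real.hasDerivAt_cos φ)
  have d3 := ((derivative (legPoly l)).hasDerivAt (Real.cos φ)).comp φ (Real.hasDerivAt_cos φ)
  have d4 := ((d1.mul ((Real.hasDerivAt_sin φ).mul d3).neg).add
    (((Real.hasDerivAt_cos φ).mul d2).div (d1.const_mul 2) (by positivity))).div_const ((l:ℝ) + 1 / 2)
  refine d4.congr_deriv ?_
  have ode := leg_ode l (Real.cos φ)
  have hsc := Real.sin_sq_add_cos_sq φ
  simp only [uFun, Function.comp_apply, Pi.mul_apply, Pi.neg_apply]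
  have hqs : √(Real.sin φ) ^ 2 = Real.sin φ := Real.sq_sqrt hs.le
  set q := √(Real.sin φ) with hqd
  rw [← hqs] at hsc ⊢
  generalize Real.cos φ = c at *
  generalize eval c (legPoly l) = p0 at *
  generalize eval c (derivative (legPoly l)) = p1 at *
  generalize eval c (derivative (derivative (legPoly l))) = p2 at *
  have hc2 : c ^ 2 = 1 - q ^ 4 := by linarith
  have ode2 : q ^ 4 * p2 = 2 * c * p1 - l * (l + 1) * p0 := by
    rw [hc2] at ode; linarith
  generalize hlam : (l:ℝ) + 1 / 2 = lam at *
  have hl2 : (l:ℝ) * (l + 1) = lam ^ 2 - 1 / 4 := by rw [← hlam]; ring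
  rw [hl2] at ode2
  field_simp
  linear_combination 16 * q ^ 4 * ode2 - 4 * p0 * hc2

lemma pert (R t v e : ℝ) (hR : 0 ≤ R) (ht : 1 ≤ t) (hv : |v| ≤ R) (he : |e| ≤ 10 * R / t) :
    |(v + e) ^ 4 - v ^ 4| ≤ 14640 * R ^ 4 / t := by
  have he2 : |e| ≤ 10 * R := he.trans (div_le_self (by positivity) ht)
  have h1 : |2 * v + e| ≤ 12 * R := by rw [abs_le] at *; constructor <;> linarith [hv.1, hv.2, he2.1, he2.2]
  have h3 : |v + e| ≤ 11 * R := by rw [abs_le] at *; constructor <;> linarith [hv.1, hv.2, he2.1, he2.2]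
  have h2 : (v + e) ^ 2 + v ^ 2 ≤ 122 * R ^ 2 := by
    rw [← sq_abs (v + e), ← sq_abs v]
    have := pow_le_pow_left₀ (abs_nonneg _) h3 2
    have := pow_le_pow_left₀ (abs_nonneg _) hv 2
    linarith
  rw [show (v + e) ^ 4 - v ^ 4 = e * (2 * v + e) * ((v + e) ^ 2 + v ^ 2) by ring, abs_mul, abs_mul,
    abs_of_nonneg (by positivity : 0 ≤ (v + e) ^ 2 + v ^ 2)]
  calc |e| * |2 * v + e| * ((v + e) ^ 2 + v ^ 2) ≤ (10 * R / t) * (12 * R) * (122 * R ^ 2) := by gcongr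
    _ = _ := by ring

/-- Perturbation form of the hypothesis of `core`. -/
lemma pert2 (lam φ M ρ0 s v e R : ℝ) (hl : 0 < lam) (hφ : 0 < φ) (hM : 0 ≤ M) (hR : 0 ≤ R) (hR2 : R ^ 2 = 2 * ρ0)
    (ht : 1 ≤ lam * φ) (hs : φ / 2 ≤ s)
    (hv : |v| ≤ R) (he : |e| ≤ 10 * R / (lam * φ)) :
    |M * (v + e) ^ 4 / s - M * (v ^ 4 / s)| ≤ 117120 * M * ρ0 ^ 2 / (lam * φ ^ 2) := by
  have h := pert R (lam * φ) v e hR ht hv he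
  have hs0 : 0 < s := by linarith
  rw [show R ^ 4 = (R ^ 2) ^ 2 by ring, hR2] at h
  rw [show M * (v + e) ^ 4 / s - M * (v ^ 4 / s) = M * ((v + e) ^ 4 - v ^ 4) / s by ring, abs_div, abs_mul,
    abs_of_nonneg hM, abs_of_pos hs0]
  calc M * |(v + e) ^ 4 - v ^ 4| / s ≤ M * (14640 * (2 * ρ0) ^ 2 / (lam * φ)) / (φ / 2) := by gcongr
    _ = _ := by field_simp; ring

lemma pow_sub_one_le (t : ℝ) (h1 : 1 ≤ t) (h2 : t ≤ 2) (n : ℕ) : t ^ n - 1 ≤ 2 ^ n * (t - 1) := by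
  induction n with
  | zero => simp; linarith
  | succ n ih =>
    have h3 : (1:ℝ) ≤ 2 ^ n := one_le_pow₀ (by norm_num)
    have h4 : t ^ n ≤ 2 ^ n := pow_le_pow_left₀ (by linarith) h2 n
    calc t ^ (n + 1) - 1 = (t ^ n - 1) + t ^ n * (t - 1) := by ring
      _ ≤ 2 ^ n * (t - 1) + 2 ^ n * (t - 1) := by gcongr
      _ = _ := by ring

set_option maxHeartbeats 4000000 in
lemma assemble (n l : ℕ) (hl : 1 ≤ l) (lam ρ0 K : ℝ) (hlam : lam = (l:ℝ) + 1 / 2) (hK : 0 ≤ K) (hρ0 : 0 ≤ ρ0)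
    (hρ : |(l:ℝ) * ρ0 * (π / 2) - 1| ≤ 4 / (l:ℝ)) (f : ℝ → ℝ) (hf : Continuous f)
    (hz : ∀ φ ∈ Set.Ioc 0 (1 / lam), |f φ| ≤ 81 * lam ^ n * (1 / lam))
    (hm : |(∫ φ in (1/lam)..(π/2), f φ) - lam ^ n * (3 / 8 * ρ0 ^ 2 * Real.log lam)| ≤ K * (lam ^ n * ρ0 ^ 2)) :
    |(∫ φ in (0:ℝ)..(π/2), f φ) - 3 / (2 * π ^ 2) * ((l:ℝ) ^ n / (l:ℝ) ^ 2) * Real.log l| ≤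
      (16 * K * 2 ^ n + 81 * 2 ^ n + 1 + 2 * (24 + 25 * 2 ^ n)) * ((l:ℝ) ^ n / (l:ℝ) ^ 2) := by
  have hpi := Real.pi_gt_three
  have hl1 : (1:ℝ) ≤ l := by exact_mod_cast hl
  have hl0 : (0:ℝ) < l := by linarith
  have hlam0 : 0 < lam := by rw [hlam]; positivity
  have hlaml : (l:ℝ) ≤ lam := by rw [hlam]; linarith
  have hlam2 : lam ≤ 2 * l := by rw [hlam]; linarith
  set N : ℝ := (l:ℝ) ^ n / (l:ℝ) ^ 2 with hN
  have hN0 : 0 < N := by positivity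
  have hlN : lam ^ n ≤ 2 ^ n * (l:ℝ) ^ n := by
    rw [← mul_pow]; exact pow_le_pow_left₀ hlam0.le hlam2 n
  -- part near zero
  have Z : |∫ φ in (0:ℝ)..(1/lam), f φ| ≤ 81 * 2 ^ n * N := by
    have h1 := intervalIntegral.norm_integral_le_of_norm_le_const (a := 0) (b := 1 / lam) (f := f)
      (C := 81 * lam ^ n * (1 / lam)) (by
        intro x hx
        rw [Set.uIoc_of_le (by positivity)] at hx
        exact hz x hx)
    rw [Real.norm_eq_abs, sub_zero, abs_of_pos (by positivity : 0 < 1 / lam)] at h1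
    calc _ ≤ _ := h1
      _ = 81 * lam ^ n / lam ^ 2 := by field_simp
      _ ≤ 81 * (2 ^ n * (l:ℝ) ^ n) / (l:ℝ) ^ 2 := by gcongr
      _ = _ := by rw [hN]; ring
  have hsplit : (∫ φ in (0:ℝ)..(π/2), f φ) = (∫ φ in (0:ℝ)..(1/lam), f φ) + ∫ φ in (1/lam)..(π/2), f φ :=
    (intervalIntegral.integral_add_adjacent_intervals (hf.intervalIntegrable _ _) (hf.intervalIntegrable _ _)).symm
  set z := (l:ℝ) * ρ0 * (π / 2) with hzd
  set t := lam / l with htd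
  have ht1 : 1 ≤ t := by rw [htd, le_div_iff₀ hl0]; linarith
  have ht2 : t ≤ 2 := by rw [htd, div_le_iff₀ hl0]; linarith
  have htm : t - 1 ≤ 1 / l := by
    rw [htd, hlam, div_sub_one hl0.ne']; gcongr; linarith
  have hd1 : 1 / (l:ℝ) ≤ 1 := by rw [div_le_one hl0]; exact hl1
  have hd0 : 0 < 1 / (l:ℝ) := by positivity
  have h4 : 4 / (l:ℝ) = 4 * (1 / (l:ℝ)) := by ring
  rw [h4] at hρ
  have hz5 : z ≤ 5 := by linarith [(abs_le.1 hρ).2]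
  have hz0 : 0 ≤ z := by positivity
  have hρl : ρ0 ≤ 4 / l := by
    rw [le_div_iff₀ hl0]
    nlinarith [mul_nonneg hl0.le hρ0]
  have hmain : lam ^ n * (3 / 8 * ρ0 ^ 2 * Real.log lam) = 3 / (2 * π ^ 2) * N * (t ^ n * z ^ 2 * Real.log lam) := by
    rw [hN, htd, hzd, div_pow]
    field_simp
    ring
  have hpw := pow_sub_one_le t ht1 ht2 n
  have hp1 : 1 ≤ t ^ n := one_le_pow₀ ht1
  have hp2 : t ^ n ≤ 2 ^ n := pow_le_pow_left₀ (by linarith) ht2 n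
  have hz2 : |z ^ 2 - 1| ≤ 24 * (1 / (l:ℝ)) := by
    rw [show z ^ 2 - 1 = (z - 1) * (z + 1) by ring, abs_mul, abs_of_nonneg (by linarith : 0 ≤ z + 1)]
    calc |z - 1| * (z + 1) ≤ (4 * (1 / (l:ℝ))) * 6 := by gcongr; linarith
      _ = _ := by ring
  have hB : |t ^ n * z ^ 2 - 1| ≤ (24 * 2 ^ n + 2 ^ n) * (1 / (l:ℝ)) := by
    have a1 : |t ^ n * (z ^ 2 - 1)| ≤ 2 ^ n * (24 * (1 / (l:ℝ))) := by
      rw [abs_mul, abs_of_pos (by linarith)]; gcongr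
    have a2 : t ^ n - 1 ≤ 2 ^ n * (1 / (l:ℝ)) := hpw.trans (by gcongr)
    rw [abs_le] at *
    constructor <;> linarith [a1.1, a1.2]
  have hlog0 : 0 ≤ Real.log lam := Real.log_nonneg (by linarith)
  have hlog1 : Real.log lam ≤ 2 * l := (Real.log_le_self hlam0.le).trans hlam2
  have hlog2 : Real.log lam - Real.log l ≤ 1 := by
    rw [← Real.log_div hlam0.ne' hl0.ne']
    have := Real.log_le_sub_one_of_pos (x := t) (by positivity)
    linarith
  have hlog3 : 0 ≤ Real.log lam - Real.log l := by
    have := Real.log_le_log hl0 hlaml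
    linarith
  have hD : |t ^ n * z ^ 2 * Real.log lam - Real.log l| ≤ 2 * (25 * 2 ^ n) + 1 := by
    have : |(t ^ n * z ^ 2 - 1) * Real.log lam| ≤ 2 * (25 * 2 ^ n) := by
      rw [abs_mul, abs_of_nonneg hlog0]
      calc _ ≤ (24 * 2 ^ n + 2 ^ n) * (1 / (l:ℝ)) * (2 * l) := by gcongr
        _ = _ := by field_simp; ring
    rw [abs_le] at *
    constructor <;> linarith [this.1, this.2]
  have hpc : 3 / (2 * π ^ 2) ≤ 1 := by
    rw [div_le_one (by positivity)]; nlinarith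
  have hE : |3 / (2 * π ^ 2) * N * (t ^ n * z ^ 2 * Real.log lam) - 3 / (2 * π ^ 2) * N * Real.log l| ≤ (2 * (25 * 2 ^ n) + 1) * N := by
    rw [← mul_sub, abs_mul, abs_of_pos (by positivity)]
    calc _ ≤ 1 * N * (2 * (25 * 2 ^ n) + 1) := by gcongr
      _ = _ := by ring
  have hF : K * (lam ^ n * ρ0 ^ 2) ≤ 16 * K * 2 ^ n * N := by
    calc _ ≤ K * ((2 ^ n * (l:ℝ) ^ n) * (4 / l) ^ 2) := by gcongr
      _ = _ := by rw [hN]; field_simp; ring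
  rw [hsplit]
  rw [hmain] at hm
  have hm' := hm.trans hF
  rw [abs_le] at *
  constructor <;> nlinarith [hm'.1, hm'.2, hE.1, hE.2, Z.1, Z.2]

/-- The energy at `π/2`. -/
noncomputable def rho0 (l : ℕ) : ℝ := uFun l (π/2) ^ 2 + wFun l (π/2) ^ 2

lemma rho0_nonneg (l : ℕ) : 0 ≤ rho0 l := by unfold rho0; positivity

lemma rho0_bound (l : ℕ) (hl : 1 ≤ l) : |(l:ℝ) * rho0 l * (π / 2) - 1| ≤ 4 / (l:ℝ) := by
  have h := rho_bound l hl
  have e : rho0 l = (legPoly l).eval 0 ^ 2 + ((Polynomial.derivative (legPoly l)).eval 0 / ((l:ℝ) + 1/2)) ^ 2 := by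
    simp only [rho0, uFun, wFun, Real.sin_pi_div_two, Real.cos_pi_div_two, Real.sqrt_one]
    ring
  rw [e]; exact h

lemma uw_bound (l : ℕ) (hl : 1 ≤ l) (φ : ℝ) (h : φ ∈ Set.Icc (1 / ((l:ℝ) + 1/2)) (π/2)) :
    |uFun l φ| ≤ √(2 * rho0 l) ∧ |wFun l φ| ≤ √(2 * rho0 l) := by
  have hl1 : (1:ℝ) ≤ l := by exact_mod_cast hl
  have g := gron ((l:ℝ) + 1/2) (by linarith) (uFun l) (wFun l) (uFun_deriv l) (wFun_deriv l) φ h.1 h.2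
  have hlp : 1 ≤ ((l:ℝ) + 1/2) * φ := by
    have := h.1
    rw [div_le_iff₀ (by positivity)] at this; linarith
  have h0 := rho0_nonneg l
  change |_ - rho0 l| ≤ rho0 l / _ at g
  have : rho0 l / (((l:ℝ) + 1/2) * φ) ≤ rho0 l := div_le_self h0 hlp
  have := (abs_le.1 g).2
  constructor
  · apply Real.abs_le_sqrt; nlinarith [sq_nonneg (wFun l φ)]
  · apply Real.abs_le_sqrt; nlinarith [sq_nonneg (uFun l φ)]

open Polynomial in
lemma id0 (l : ℕ) (φ : ℝ) (h : 0 < Real.sin φ) :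
    ((legPoly l).eval (Real.cos φ)) ^ 4 * Real.sin φ = uFun l φ ^ 4 / Real.sin φ := by
  have hqs : √(Real.sin φ) ^ 2 = Real.sin φ := Real.sq_sqrt h.le
  rw [uFun, mul_pow, show √(Real.sin φ) ^ 4 = (√(Real.sin φ) ^ 2) ^ 2 by ring, hqs]
  field_simp

open Polynomial in
lemma id1 (l : ℕ) (φ : ℝ) (h : 0 < Real.sin φ) :
    ((derivative (legPoly l)).eval (Real.cos φ) * Real.sin φ) ^ 4 * Real.sin φ =
      ((l:ℝ) + 1/2) ^ 4 * (wFun l φ + -(Real.cos φ * uFun l φ / (2 * Real.sin φ * ((l:ℝ) + 1/2)))) ^ 4 / Real.sin φ := by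
  have hq : 0 < √(Real.sin φ) := Real.sqrt_pos.2 h
  have hqs : √(Real.sin φ) ^ 2 = Real.sin φ := Real.sq_sqrt h.le
  have hl : (0:ℝ) < (l:ℝ) + 1 / 2 := by positivity
  rw [uFun, wFun]
  generalize √(Real.sin φ) = q at *
  rw [← hqs]
  generalize (l:ℝ) + 1 / 2 = lam at *
  generalize Real.cos φ = c at *
  generalize eval c (legPoly l) = p0 at *
  generalize eval c (derivative (legPoly l)) = p1 at *
  have : (q * -(q ^ 2 * p1) + c * p0 / (2 * q)) / lam + -(c * (q * p0) / (2 * q ^ 2 * lam)) = - (q ^ 3 * p1) / lam := by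
    field_simp; ring
  rw [this]
  field_simp

open Polynomial in
lemma id2 (l : ℕ) (φ : ℝ) (h : 0 < Real.sin φ) :
    ((derivative (derivative (legPoly l))).eval (Real.cos φ) * Real.sin φ ^ 2) ^ 4 * Real.sin φ =
      ((l:ℝ) + 1/2) ^ 8 * (uFun l φ + (2 * Real.cos φ * wFun l φ / (((l:ℝ) + 1/2) * Real.sin φ)
        - Real.cos φ ^ 2 * uFun l φ / (((l:ℝ) + 1/2) ^ 2 * Real.sin φ ^ 2)
        - uFun l φ / (4 * ((l:ℝ) + 1/2) ^ 2))) ^ 4 / Real.sin φ := by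
  have hq : 0 < √(Real.sin φ) := Real.sqrt_pos.2 h
  have hqs : √(Real.sin φ) ^ 2 = Real.sin φ := Real.sq_sqrt h.le
  have hl : (0:ℝ) < (l:ℝ) + 1 / 2 := by positivity
  have ode := leg_ode l (Real.cos φ)
  have hsc := Real.sin_sq_add_cos_sq φ
  rw [uFun, wFun]
  generalize √(Real.sin φ) = q at *
  rw [← hqs] at hsc ⊢
  generalize Real.cos φ = c at *
  generalize eval c (legPoly l) = p0 at *
  generalize eval c (derivative (legPoly l)) = p1 at *
  generalize eval c (derivative (derivative (legPoly l))) = p2 at *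
  have hc2 : c ^ 2 = 1 - q ^ 4 := by linarith
  have ode2 : q ^ 4 * p2 = 2 * c * p1 - l * (l + 1) * p0 := by
    rw [hc2] at ode; linarith
  generalize hlam : (l:ℝ) + 1 / 2 = lam at *
  have hl2 : (l:ℝ) * (l + 1) = lam ^ 2 - 1 / 4 := by rw [← hlam]; ring
  rw [hl2] at ode2
  have : q * p0 + (2 * c * ((q * -(q ^ 2 * p1) + c * p0 / (2 * q)) / lam) / (lam * q ^ 2)
      - c ^ 2 * (q * p0) / (lam ^ 2 * (q ^ 2) ^ 2) - q * p0 / (4 * lam ^ 2)) = - (q ^ 5 * p2) / lam ^ 2 := by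
    rw [show q ^ 5 * p2 = q * (q ^ 4 * p2) by ring, ode2]
    field_simp
    ring
  rw [this]
  field_simp

lemma main0 (l : ℕ) (hl : 1 ≤ l) :
    |(∫ φ in (0 : ℝ)..(π / 2), ((legPoly l).eval (Real.cos φ)) ^ 4 * Real.sin φ)
        - 3 / (2 * π ^ 2) * ((l : ℝ) ^ 0 / (l : ℝ) ^ 2) * Real.log l| ≤
      (16 * (117120 + 200) * 2 ^ 0 + 81 * 2 ^ 0 + 1 + 2 * (24 + 25 * 2 ^ 0)) * ((l:ℝ) ^ 0 / (l:ℝ) ^ 2) := by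
  have hl1 : (1:ℝ) ≤ l := by exact_mod_cast hl
  have hr0 := rho0_nonneg l
  have hpi := Real.pi_gt_three
  have hc : Continuous (fun φ => ((legPoly l).eval (Real.cos φ)) ^ 4 * Real.sin φ) := by fun_prop
  have hlam1 : 1 ≤ (l:ℝ) + 1 / 2 := by linarith
  apply assemble 0 l hl ((l:ℝ) + 1/2) (rho0 l) (117120 + 200) rfl (by norm_num) hr0 (rho0_bound l hl) _ hc
  · intro φ hφ
    have h1 : 1 / ((l:ℝ) + 1/2) ≤ 1 := by rw [div_le_one (by positivity)]; exact hlam1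
    have hcos : 0 ≤ Real.cos φ := Real.cos_nonneg_of_mem_Icc ⟨by linarith [hφ.1], by linarith [hφ.2]⟩
    have b := leg_bound l hl _ hcos (Real.cos_le_one φ)
    have hs := Real.sin_le hφ.1.le
    have hs0 : 0 ≤ Real.sin φ := Real.sin_nonneg_of_nonneg_of_le_pi hφ.1.le (by linarith [hφ.2])
    rw [abs_mul, abs_pow, abs_of_nonneg hs0]
    calc |Polynomial.eval (Real.cos φ) (legPoly l)| ^ 4 * Real.sin φ ≤ 1 ^ 4 * (1 / ((l:ℝ) + 1/2)) := by
          gcongr; exact hs.trans hφ.2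
      _ ≤ _ := by gcongr; norm_num
  · apply core _ hlam1 (uFun l) (wFun l) (uFun_deriv l) (wFun_deriv l) _ rfl (-5/8) (-3/8)
      (by rw [abs_le]; norm_num) (by rw [abs_le]; norm_num) 117120 _ (by positivity) (by norm_num) _ hc
    intro φ hφ
    have hφ0 : 0 < φ := lt_of_lt_of_le (by positivity) hφ.1
    have hs := sin_lower hφ0 hφ.2
    rw [id0 l φ (by linarith), show ∀ u w : ℝ, (-5/8) * (3 * u ^ 2 * w ^ 2 - u ^ 4) + (-3/8) * (w ^ 4 - 3 * u ^ 2 * w ^ 2)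
        + 3 / 8 * (u ^ 2 + w ^ 2) ^ 2 = u ^ 4 by intros; ring]
    rw [pow_zero, one_mul, sub_self, abs_zero]
    positivity

lemma main1 (l : ℕ) (hl : 1 ≤ l) :
    |(∫ φ in (0 : ℝ)..(π / 2), ((Polynomial.derivative (legPoly l)).eval (Real.cos φ) * Real.sin φ) ^ 4 * Real.sin φ)
        - 3 / (2 * π ^ 2) * ((l : ℝ) ^ 4 / (l : ℝ) ^ 2) * Real.log l| ≤
      (16 * (117120 + 200) * 2 ^ 4 + 81 * 2 ^ 4 + 1 + 2 * (24 + 25 * 2 ^ 4)) * ((l:ℝ) ^ 4 / (l:ℝ) ^ 2) := by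
  have hl1 : (1:ℝ) ≤ l := by exact_mod_cast hl
  have hr0 := rho0_nonneg l
  have hpi := Real.pi_gt_three
  have hc : Continuous (fun φ => ((Polynomial.derivative (legPoly l)).eval (Real.cos φ) * Real.sin φ) ^ 4 * Real.sin φ) := by fun_prop
  have hlam1 : 1 ≤ (l:ℝ) + 1 / 2 := by linarith
  apply assemble 4 l hl ((l:ℝ) + 1/2) (rho0 l) (117120 + 200) rfl (by norm_num) hr0 (rho0_bound l hl) _ hc
  · intro φ hφ
    have h1 : 1 / ((l:ℝ) + 1/2) ≤ 1 := by rw [div_le_one (by positivity)]; exact hlam1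
    have hcos : 0 ≤ Real.cos φ := Real.cos_nonneg_of_mem_Icc ⟨by linarith [hφ.1], by linarith [hφ.2]⟩
    have hcos1 : Real.cos φ < 1 := by
      have := Real.cos_lt_cos_of_nonneg_of_le_pi le_rfl (by linarith [hφ.2] : φ ≤ π) hφ.1
      rwa [Real.cos_zero] at this
    have b := leg_deriv_bound l hl _ hcos hcos1
    have hs := (Real.sin_le hφ.1.le).trans hφ.2
    have hs0 : 0 ≤ Real.sin φ := Real.sin_nonneg_of_nonneg_of_le_pi hφ.1.le (by linarith [hφ.2])
    rw [abs_mul, abs_pow, abs_mul, abs_of_nonneg hs0]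
    have b2 : |Polynomial.eval (Real.cos φ) (Polynomial.derivative (legPoly l))| ≤ ((l:ℝ) + 1/2) ^ 2 := by nlinarith
    calc (|Polynomial.eval (Real.cos φ) (Polynomial.derivative (legPoly l))| * Real.sin φ) ^ 4 * Real.sin φ
          ≤ (((l:ℝ) + 1/2) ^ 2 * (1 / ((l:ℝ) + 1/2))) ^ 4 * (1 / ((l:ℝ) + 1/2)) := by gcongr
      _ = 1 * ((l:ℝ) + 1/2) ^ 4 * (1 / ((l:ℝ) + 1/2)) := by
          rw [show ((l:ℝ) + 1/2) ^ 2 * (1 / ((l:ℝ) + 1/2)) = (l:ℝ) + 1/2 by field_simp, one_mul]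
      _ ≤ _ := by gcongr; norm_num
  · apply core _ hlam1 (uFun l) (wFun l) (uFun_deriv l) (wFun_deriv l) _ rfl (3/8) (5/8)
      (by rw [abs_le]; norm_num) (by rw [abs_le]; norm_num) 117120 _ (by positivity) (by norm_num) _ hc
    intro φ hφ
    have hφ0 : 0 < φ := lt_of_lt_of_le (by positivity) hφ.1
    have hs := sin_lower hφ0 hφ.2
    have hs0 : 0 < Real.sin φ := by linarith
    have hlp : 1 ≤ ((l:ℝ) + 1/2) * φ := by
      have := hφ.1
      rw [div_le_iff₀ (by positivity)] at this; linarith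
    obtain ⟨bu, bw⟩ := uw_bound l hl φ hφ
    rw [id1 l φ hs0, show ∀ u w : ℝ, (3/8) * (3 * u ^ 2 * w ^ 2 - u ^ 4) + (5/8) * (w ^ 4 - 3 * u ^ 2 * w ^ 2)
        + 3 / 8 * (u ^ 2 + w ^ 2) ^ 2 = w ^ 4 by intros; ring]
    refine pert2 _ φ _ _ _ _ _ (√(2 * rho0 l)) (by positivity) hφ0 (by positivity) (Real.sqrt_nonneg _)
      (Real.sq_sqrt (by positivity)) hlp hs bw ?_
    have hR := Real.sqrt_nonneg (2 * rho0 l)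
    rw [abs_neg, abs_div, abs_mul, abs_of_pos (by positivity : 0 < 2 * Real.sin φ * ((l:ℝ) + 1/2))]
    have hc1 := Real.abs_cos_le_one φ
    calc |Real.cos φ| * |uFun l φ| / (2 * Real.sin φ * ((l:ℝ) + 1/2))
        ≤ 1 * √(2 * rho0 l) / (2 * (φ / 2) * ((l:ℝ) + 1/2)) := by gcongr
      _ = 1 * √(2 * rho0 l) / (((l:ℝ) + 1/2) * φ) := by congr 1; ring
      _ ≤ _ := by gcongr; norm_num

lemma main2 (l : ℕ) (hl : 1 ≤ l) :
    |(∫ φ in (0 : ℝ)..(π / 2), ((Polynomial.derivative (Polynomial.derivative (legPoly l))).eval (Real.cos φ) * Real.sin φ ^ 2) ^ 4 * Real.sin φ)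
        - 3 / (2 * π ^ 2) * ((l : ℝ) ^ 8 / (l : ℝ) ^ 2) * Real.log l| ≤
      (16 * (117120 + 200) * 2 ^ 8 + 81 * 2 ^ 8 + 1 + 2 * (24 + 25 * 2 ^ 8)) * ((l:ℝ) ^ 8 / (l:ℝ) ^ 2) := by
  have hl1 : (1:ℝ) ≤ l := by exact_mod_cast hl
  have hr0 := rho0_nonneg l
  have hpi := Real.pi_gt_three
  have hc : Continuous (fun φ => ((Polynomial.derivative (Polynomial.derivative (legPoly l))).eval (Real.cos φ) * Real.sin φ ^ 2) ^ 4 * Real.sin φ) := by fun_prop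
  have hlam1 : 1 ≤ (l:ℝ) + 1 / 2 := by linarith
  apply assemble 8 l hl ((l:ℝ) + 1/2) (rho0 l) (117120 + 200) rfl (by norm_num) hr0 (rho0_bound l hl) _ hc
  · intro φ hφ
    have h1 : 1 / ((l:ℝ) + 1/2) ≤ 1 := by rw [div_le_one (by positivity)]; exact hlam1
    have hcos : 0 ≤ Real.cos φ := Real.cos_nonneg_of_mem_Icc ⟨by linarith [hφ.1], by linarith [hφ.2]⟩
    have hcos1 : Real.cos φ < 1 := by
      have := Real.cos_lt_cos_of_nonneg_of_le_pi le_rfl (by linarith [hφ.2] : φ ≤ π) hφ.1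
      rwa [Real.cos_zero] at this
    have b0 := leg_bound l hl _ hcos hcos1.le
    have b := leg_deriv_bound l hl _ hcos hcos1
    have hs := (Real.sin_le hφ.1.le).trans hφ.2
    have hs0 : 0 ≤ Real.sin φ := Real.sin_nonneg_of_nonneg_of_le_pi hφ.1.le (by linarith [hφ.2])
    have ode := leg_ode l (Real.cos φ)
    rw [Real.cos_sq'] at ode
    have e : Polynomial.eval (Real.cos φ) (Polynomial.derivative (Polynomial.derivative (legPoly l))) * Real.sin φ ^ 2
      = 2 * (Real.cos φ * Polynomial.eval (Real.cos φ) (Polynomial.derivative (legPoly l))) - (l * (l + 1)) * Polynomial.eval (Real.cos φ) (legPoly l) := by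
      linarith
    rw [e, abs_mul, abs_pow, abs_of_nonneg hs0]
    have c1 : |Real.cos φ * Polynomial.eval (Real.cos φ) (Polynomial.derivative (legPoly l))| ≤ 1 * (l * (l + 1)) := by
      rw [abs_mul]
      have hc1 := Real.abs_cos_le_one φ
      gcongr
    have c2 : |((l:ℝ) * (l + 1)) * Polynomial.eval (Real.cos φ) (legPoly l)| ≤ (l * (l + 1)) * 1 := by
      rw [abs_mul, abs_of_nonneg (by positivity)]
      gcongr
    have c3 : |2 * (Real.cos φ * Polynomial.eval (Real.cos φ) (Polynomial.derivative (legPoly l))) - (l * (l + 1)) * Polynomial.eval (Real.cos φ) (legPoly l)| ≤ 3 * ((l:ℝ) + 1/2) ^ 2 := by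
      rw [abs_le] at *
      constructor <;> nlinarith [c1.1, c1.2, c2.1, c2.2]
    calc _ ≤ (3 * ((l:ℝ) + 1/2) ^ 2) ^ 4 * (1 / ((l:ℝ) + 1/2)) := by gcongr
      _ = _ := by ring
  · apply core _ hlam1 (uFun l) (wFun l) (uFun_deriv l) (wFun_deriv l) _ rfl (-5/8) (-3/8)
      (by rw [abs_le]; norm_num) (by rw [abs_le]; norm_num) 117120 _ (by positivity) (by norm_num) _ hc
    intro φ hφ
    have hφ0 : 0 < φ := lt_of_lt_of_le (by positivity) hφ.1
    have hs := sin_lower hφ0 hφ.2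
    have hs0 : 0 < Real.sin φ := by linarith
    have hlp : 1 ≤ ((l:ℝ) + 1/2) * φ := by
      have := hφ.1
      rw [div_le_iff₀ (by positivity)] at this; linarith
    obtain ⟨bu, bw⟩ := uw_bound l hl φ hφ
    rw [id2 l φ hs0, show ∀ u w : ℝ, (-5/8) * (3 * u ^ 2 * w ^ 2 - u ^ 4) + (-3/8) * (w ^ 4 - 3 * u ^ 2 * w ^ 2)
        + 3 / 8 * (u ^ 2 + w ^ 2) ^ 2 = u ^ 4 by intros; ring]
    refine pert2 _ φ _ _ _ _ _ (√(2 * rho0 l)) (by positivity) hφ0 (by positivity) (Real.sqrt_nonneg _)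
      (Real.sq_sqrt (by positivity)) hlp hs bu ?_
    have hR := Real.sqrt_nonneg (2 * rho0 l)
    have hc1 := Real.abs_cos_le_one φ
    have hφ2 : φ ≤ 2 := by linarith [hφ.2, Real.pi_le_four]
    generalize √(2 * rho0 l) = R at *
    generalize (l:ℝ) + 1 / 2 = lam at *
    have hlam0 : 0 < lam := by linarith
    have e1 : |2 * Real.cos φ * wFun l φ / (lam * Real.sin φ)| ≤ 4 * (R / (lam * φ)) := by
      rw [abs_div, abs_mul, abs_mul, abs_of_pos (by positivity : 0 < lam * Real.sin φ), abs_of_pos (by norm_num : (0:ℝ) < 2)]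
      calc 2 * |Real.cos φ| * |wFun l φ| / (lam * Real.sin φ) ≤ 2 * 1 * R / (lam * (φ / 2)) := by gcongr
        _ = _ := by field_simp; ring
    have e2 : |Real.cos φ ^ 2 * uFun l φ / (lam ^ 2 * Real.sin φ ^ 2)| ≤ 4 * (R / (lam * φ)) := by
      rw [abs_div, abs_mul, abs_pow, abs_of_pos (by positivity : 0 < lam ^ 2 * Real.sin φ ^ 2)]
      calc |Real.cos φ| ^ 2 * |uFun l φ| / (lam ^ 2 * Real.sin φ ^ 2) ≤ 1 ^ 2 * R / (lam ^ 2 * (φ / 2) ^ 2) := by gcongr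
        _ = 4 * (R / (lam * φ)) / (lam * φ) := by field_simp; ring
        _ ≤ _ := div_le_self (by positivity) hlp
    have e3 : |uFun l φ / (4 * lam ^ 2)| ≤ R / (lam * φ) := by
      rw [abs_div, abs_of_pos (by positivity : 0 < 4 * lam ^ 2)]
      have : lam * φ ≤ 4 * lam ^ 2 := by nlinarith
      gcongr
    have e4 : 10 * R / (lam * φ) = 10 * (R / (lam * φ)) := by ring
    have e5 : 0 ≤ R / (lam * φ) := by positivity
    rw [e4]
    rw [abs_le] at e1 e2 e3 ⊢
    constructor <;> linarith [e1.1, e1.2, e2.1, e2.2, e3.1, e3.2]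

/-- For `r ∈ {0,1,2}`, as `ℓ → ∞`,
`∫₀^{π/2} [P_ℓ^{(r)}(cos φ)·sin^r φ]⁴ sin φ dφ = (3/(2π²))·ℓ^{4r−2}·log ℓ + O(ℓ^{4r−2})`. -/
theorem integral_fourth_power_legendre_deriv_asymp :
    ∀ r ∈ ({0, 1, 2} : Set ℕ), ∃ C > (0 : ℝ), ∃ l₀ : ℕ, ∀ l : ℕ, l₀ ≤ l →
      |(∫ φ in (0 : ℝ)..(π / 2),
          (iteratedDeriv r (legendreP l) (Real.cos φ) * Real.sin φ ^ r) ^ 4 * Real.sin φ)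
        - 3 / (2 * π ^ 2) * ((l : ℝ) ^ (4 * r) / (l : ℝ) ^ 2) * Real.log l|
      ≤ C * ((l : ℝ) ^ (4 * r) / (l : ℝ) ^ 2) := by
  intro r hr
  rcases hr with rfl | rfl | rfl
  · refine ⟨16 * (117120 + 200) * 2 ^ 0 + 81 * 2 ^ 0 + 1 + 2 * (24 + 25 * 2 ^ 0), by norm_num, 1, fun l hl => ?_⟩
    have h := main0 l hl
    rw [legendreP_eq, iteratedDeriv_eval]
    simp only [Function.iterate_zero_apply, pow_zero, mul_one, mul_zero] at h ⊢
    exact h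
  · refine ⟨16 * (117120 + 200) * 2 ^ 4 + 81 * 2 ^ 4 + 1 + 2 * (24 + 25 * 2 ^ 4), by norm_num, 1, fun l hl => ?_⟩
    have h := main1 l hl
    rw [legendreP_eq, iteratedDeriv_eval]
    simp only [Function.iterate_one, pow_one, mul_one]
    exact h
  · refine ⟨16 * (117120 + 200) * 2 ^ 8 + 81 * 2 ^ 8 + 1 + 2 * (24 + 25 * 2 ^ 8), by norm_num, 1, fun l hl => ?_⟩
    exact (by
      rw [legendreP_eq, iteratedDeriv_eval]
      exact main2 l hl)
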